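/- Let r ≥ 3 be a natural number. The following 8(r−1) functions on SL(3,ℂ)^r are algebraically independent over ℂ in the ℂ-algebra of all functions SL(3,ℂ)^r → ℂ: the eight functions tr(X₁), tr(X₂), tr(X₁⁻¹), tr(X₂⁻¹), tr(X₁X₂), tr(X₁⁻¹X₂), tr(X₂⁻¹X₁), tr(X₁⁻¹X₂⁻¹), together with, for each k with 3 ≤ k ≤ r, the eight functions tr(X_k), tr(X_k⁻¹), tr(X₁X_k), tr(X₂X_k), tr(X₁X_k⁻¹), tr(X₁⁻¹X_k⁻¹), tr(X₁⁻¹X_k), tr(X₂X_k⁻¹). -/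

import Mathlib

/-- `SL(3,ℂ)`. -/
abbrev SL3 := Matrix.SpecialLinearGroup (Fin 3) ℂ

/-- Trace of an element of `SL(3,ℂ)`, as the trace of the underlying matrix. -/
noncomputable def tr3 (X : SL3) : ℂ := Matrix.trace (X : Matrix (Fin 3) (Fin 3) ℂ)

/-- The eight functions tr X₁, tr X₂, tr X₁⁻¹, tr X₂⁻¹, tr X₁X₂, tr X₁⁻¹X₂,
tr X₂⁻¹X₁, tr X₁⁻¹X₂⁻¹ (indices here are 0-based: X₁ = X 0, X₂ = X 1). -/
noncomputable def baseBlock (r : ℕ) (hr : 3 ≤ r) (j : Fin 8) (X : Fin r → SL3) : ℂ :=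
  ![tr3 (X ⟨0, by omega⟩),
    tr3 (X ⟨1, by omega⟩),
    tr3 (X ⟨0, by omega⟩)⁻¹,
    tr3 (X ⟨1, by omega⟩)⁻¹,
    tr3 (X ⟨0, by omega⟩ * X ⟨1, by omega⟩),
    tr3 ((X ⟨0, by omega⟩)⁻¹ * X ⟨1, by omega⟩),
    tr3 ((X ⟨1, by omega⟩)⁻¹ * X ⟨0, by omega⟩),
    tr3 ((X ⟨0, by omega⟩)⁻¹ * (X ⟨1, by omega⟩)⁻¹)] j


set_option linter.unusedSimpArgs false
open Topology

noncomputable def mA (w : Fin 10 → ℂ) : Matrix (Fin 3) (Fin 3) ℂ :=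
  !![w 0, 0, 0; 0, w 1, 0; 0, 0, w 2]
noncomputable def mB (w : Fin 10 → ℂ) : Matrix (Fin 3) (Fin 3) ℂ :=
  !![w 3, 1, w 8; w 6, w 4, 1; w 9, w 7, w 5]
noncomputable def mX (x : Fin 9 → ℂ) : Matrix (Fin 3) (Fin 3) ℂ :=
  !![x 0, x 1, x 2; x 3, x 4, x 5; x 6, x 7, x 8]

open Matrix in
noncomputable def baseF (w : Fin 10 → ℂ) : Fin 10 → ℂ :=
  ![trace (mA w), trace (mB w), trace (adjugate (mA w)), trace (adjugate (mB w)),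
    trace (mA w * mB w), trace (adjugate (mA w) * mB w), trace (adjugate (mB w) * mA w),
    trace (adjugate (mA w) * adjugate (mB w)), det (mA w), det (mB w)]

open Matrix in
noncomputable def blockF (w : Fin 10 → ℂ) (x : Fin 9 → ℂ) : Fin 9 → ℂ :=
  ![trace (mX x), trace (adjugate (mX x)), trace (mA w * mX x), trace (mB w * mX x),
    trace (mA w * adjugate (mX x)), trace (adjugate (mA w) * adjugate (mX x)),
    trace (adjugate (mA w) * mX x), trace (mB w * adjugate (mX x)), det (mX x)]

theorem contDiff_baseF : ContDiff ℂ 1 baseF := by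
  rw [contDiff_pi]
  intro i
  fin_cases i <;>
  simp [baseF, mA, mB, Matrix.trace_fin_three, Matrix.det_fin_three, Matrix.adjugate_fin_three,
    Matrix.mul_apply, Fin.sum_univ_three] <;> fun_prop

theorem contDiff_blockF :
    ContDiff ℂ 1 (fun p : (Fin 10 → ℂ) × (Fin 9 → ℂ) => blockF p.1 p.2) := by
  rw [contDiff_pi]
  intro i
  fin_cases i <;>
  simp [blockF, mA, mB, mX, Matrix.trace_fin_three, Matrix.det_fin_three,
    Matrix.adjugate_fin_three, Matrix.mul_apply, Fin.sum_univ_three] <;> fun_prop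

noncomputable def w0 : Fin 10 → ℂ := ![1, 2, 1/2, 0, 0, 0, 1, 1, 0, 1]
noncomputable def x0 : Fin 9 → ℂ := ![0, 1, 0, 0, 0, 1, 1, 0, 1]

theorem coeff_zero (g : ℂ → ℂ) (c0 c1 c2 c3 : ℂ) (h : HasDerivAt g 0 0)
    (hg : ∀ t, g t = c0 + c1 * t + c2 * t ^ 2 + c3 * t ^ 3) : c1 = 0 := by
  have h2 : HasDerivAt g c1 0 := by
    have : g = fun t => c0 + c1 * t + c2 * t ^ 2 + c3 * t ^ 3 := funext hg
    rw [this]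
    have := ((((hasDerivAt_const (0:ℂ) c0).add ((hasDerivAt_id (0:ℂ)).const_mul c1)).add
      ((hasDerivAt_pow 2 (0:ℂ)).const_mul c2)).add ((hasDerivAt_pow 3 (0:ℂ)).const_mul c3))
    have e : c1 = 0 + c1 * 1 + c2 * ((2:ℕ) * 0 ^ (2 - 1)) + c3 * ((3:ℕ) * 0 ^ (3 - 1)) := by
      simp
    rw [← e] at this
    exact this
  exact h2.unique h

theorem base_inj (w : Fin 10 → ℂ)
    (h : ∀ i, HasDerivAt (fun t : ℂ => baseF (w0 + t • w) i) 0 0) : w = 0 := by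
  have e0 := coeff_zero _ (7/2) (w 0 + w 1 + w 2) 0 0 (h 0) (by
    intro t; simp [baseF, w0, mA, Matrix.trace_fin_three]; ring)
  have e2 := coeff_zero _ (7/2) ((w 0*2+w 1)+(w 0/2+w 2)+(w 1/2+2*w 2))
    (w 0 * w 1 + w 0 * w 2 + w 1 * w 2) 0 (h 2) (by
    intro t; simp [baseF, w0, mA, Matrix.trace_fin_three, Matrix.adjugate_fin_three]; ring)
  have e8 := coeff_zero _ 1 (w 0 + w 1/2 + 2*w 2)
    (w 0 * w 1 * (1/2) + w 0 * w 2 * 2 + w 1 * w 2) (w 0 * w 1 * w 2) (h 8) (by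
    intro t; simp [baseF, w0, mA, Matrix.det_fin_three]; ring)
  have z0 : w 0 = 0 := by grind
  have z1 : w 1 = 0 := by grind
  have z2 : w 2 = 0 := by grind
  have e1 := coeff_zero _ 0 (w 3 + w 4 + w 5) 0 0 (h 1) (by
    intro t; simp [baseF, w0, mB, Matrix.trace_fin_three]; ring)
  have e4 := coeff_zero _ 0 (w 3 + 2 * w 4 + w 5 / 2) 0 0 (h 4) (by
    intro t; simp [baseF, w0, mA, mB, Matrix.trace_fin_three, Matrix.mul_apply,
      Fin.sum_univ_three, z0, z1, z2]; ring)
  have e5 := coeff_zero _ 0 (w 3 + w 4 / 2 + 2 * w 5) 0 0 (h 5) (by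
    intro t; simp [baseF, w0, mA, mB, Matrix.trace_fin_three, Matrix.mul_apply,
      Matrix.adjugate_fin_three, Fin.sum_univ_three, z0, z1, z2]; ring)
  have z3 : w 3 = 0 := by grind
  have z4 : w 4 = 0 := by grind
  have z5 : w 5 = 0 := by grind
  have e3 := coeff_zero _ (-2) (-w 7 - w 8 - w 6) (-w 8 * w 9) 0 (h 3) (by
    intro t; simp [baseF, w0, mB, Matrix.trace_fin_three,
      Matrix.adjugate_fin_three, z3, z4, z5]; ring)
  have e6 := coeff_zero _ (-3/2) (-w 7 - 2 * w 8 - w 6 / 2) (-2 * w 8 * w 9) 0 (h 6) (by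
    intro t; simp [baseF, w0, mA, mB, Matrix.trace_fin_three, Matrix.mul_apply,
      Matrix.adjugate_fin_three, Fin.sum_univ_three, z0, z1, z2, z3, z4, z5]; ring)
  have e7 := coeff_zero _ (-3) (-w 7 - w 8 / 2 - 2 * w 6) (-w 8 * w 9 / 2) 0 (h 7) (by
    intro t; simp [baseF, w0, mA, mB, Matrix.trace_fin_three, Matrix.mul_apply,
      Matrix.adjugate_fin_three, Fin.sum_univ_three, z0, z1, z2, z3, z4, z5]; ring)
  have z6 : w 6 = 0 := by grind
  have z7 : w 7 = 0 := by grind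
  have z8 : w 8 = 0 := by grind
  have e9 := coeff_zero _ 1 (w 9) 0 0 (h 9) (by
    intro t; simp [baseF, w0, mB, Matrix.det_fin_three, z3, z4, z5, z6, z7, z8]; ring)
  ext i
  fin_cases i <;> assumption

theorem block_inj (x : Fin 9 → ℂ)
    (h : ∀ i, HasDerivAt (fun t : ℂ => blockF w0 (x0 + t • x) i) 0 0) : x = 0 := by
  have e0 := coeff_zero _ 1 (x 0 + x 4 + x 8) 0 0 (h 0) (by
    intro t; simp [blockF, x0, mX, Matrix.trace_fin_three]; ring)
  have e2 := coeff_zero _ (1/2) (x 0 + 2 * x 4 + x 8 / 2) 0 0 (h 2) (by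
    intro t; simp [blockF, w0, x0, mA, mX, Matrix.trace_fin_three, Matrix.mul_apply,
      Fin.sum_univ_three]; ring)
  have e6 := coeff_zero _ 2 (x 0 + x 4 / 2 + 2 * x 8) 0 0 (h 6) (by
    intro t; simp [blockF, w0, x0, mA, mX, Matrix.trace_fin_three, Matrix.mul_apply,
      Matrix.adjugate_fin_three, Fin.sum_univ_three]; ring)
  have z0 : x 0 = 0 := by grind
  have z4 : x 4 = 0 := by grind
  have z8 : x 8 = 0 := by grind
  have e1 := coeff_zero _ 0 (-x 7 - x 2 - x 3) (-x 5 * x 7 - x 2 * x 6 - x 1 * x 3) 0 (h 1) (by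
    intro t; simp [blockF, x0, mX, Matrix.trace_fin_three,
      Matrix.adjugate_fin_three, z0, z4, z8]; ring)
  have e4 := coeff_zero _ 0 (-x 7 - 2 * x 2 - x 3 / 2)
    (-x 5 * x 7 - 2 * x 2 * x 6 - x 1 * x 3 / 2) 0 (h 4) (by
    intro t; simp [blockF, w0, x0, mA, mX, Matrix.trace_fin_three, Matrix.mul_apply,
      Matrix.adjugate_fin_three, Fin.sum_univ_three, z0, z4, z8]; ring)
  have e5 := coeff_zero _ 0 (-x 7 - x 2 / 2 - 2 * x 3)
    (-x 5 * x 7 - x 2 * x 6 / 2 - 2 * x 1 * x 3) 0 (h 5) (by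
    intro t; simp [blockF, w0, x0, mA, mX, Matrix.trace_fin_three, Matrix.mul_apply,
      Matrix.adjugate_fin_three, Fin.sum_univ_three, z0, z4, z8]; ring)
  have z2 : x 2 = 0 := by grind
  have z3 : x 3 = 0 := by grind
  have z7 : x 7 = 0 := by grind
  have e3 := coeff_zero _ 2 (x 1 + x 5) 0 0 (h 3) (by
    intro t; simp [blockF, w0, x0, mB, mX, Matrix.trace_fin_three, Matrix.mul_apply,
      Fin.sum_univ_three, z0, z2, z3, z4, z7, z8]; ring)
  have e8 := coeff_zero _ 1 (x 1 + x 5 + x 6) (x 1 * x 5 + x 1 * x 6 + x 5 * x 6)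
    (x 1 * x 5 * x 6) (h 8) (by
    intro t; simp [blockF, x0, mX, Matrix.det_fin_three, z0, z2, z3, z4, z7, z8]; ring)
  have e7 := coeff_zero _ 2 (x 5 + x 6 - x 1 + x 1 + x 5 + x 1 + x 6)
    (x 5 * x 6 + x 1 * x 5 + x 1 * x 6) 0 (h 7) (by
    intro t; simp [blockF, w0, x0, mB, mX, Matrix.trace_fin_three, Matrix.mul_apply,
      Matrix.adjugate_fin_three, Fin.sum_univ_three, z0, z2, z3, z4, z7, z8]; ring)
  have z6 : x 6 = 0 := by grind
  have z1 : x 1 = 0 := by grind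
  have z5 : x 5 = 0 := by grind
  ext i
  fin_cases i <;> assumption

noncomputable def bigF (κ : Type) (p : (Fin 10 → ℂ) × (κ → Fin 9 → ℂ)) :
    (Fin 10 → ℂ) × (κ → Fin 9 → ℂ) :=
  (baseF p.1, fun k => blockF p.1 (p.2 k))

theorem bigF_nhds (κ : Type) [Fintype κ] :
    Filter.map (bigF κ) (𝓝 (w0, fun _ => x0)) = 𝓝 (bigF κ (w0, fun _ => x0)) := by
  have hc : ContDiff ℂ 1 (bigF κ) := by
    refine (contDiff_baseF.comp contDiff_fst).prodMk ?_
    rw [contDiff_pi]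
    intro k
    exact contDiff_blockF.comp (f := fun p : (Fin 10 → ℂ) × (κ → Fin 9 → ℂ) => (p.1, p.2 k))
      (by fun_prop)
  set a : (Fin 10 → ℂ) × (κ → Fin 9 → ℂ) := (w0, fun _ => x0) with ha
  have hs := hc.contDiffAt.hasStrictFDerivAt (x := a) one_ne_zero
  refine hs.map_nhds_eq_of_surj ?_
  rw [LinearMap.range_eq_top]
  refine (LinearMap.injective_iff_surjective (f := (fderiv ℂ (bigF κ) a).toLinearMap)).1 ?_
  rw [injective_iff_map_eq_zero]
  rintro ⟨w, x⟩ hv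
  have hline : HasDerivAt (fun t : ℂ => bigF κ (a + t • (w, x))) 0 0 := by
    have h1 : HasDerivAt (fun t : ℂ => a + t • (w, x)) (w, x) 0 := by
      simpa using ((hasDerivAt_id (0:ℂ)).smul_const (w, x)).const_add a
    have h2 : HasFDerivAt (bigF κ) (fderiv ℂ (bigF κ) a) (a + (0:ℂ) • (w, x)) := by
      simpa using hs.hasFDerivAt
    have h3 := h2.comp_hasDerivAt (0:ℂ) h1
    have hv' : (fderiv ℂ (bigF κ) a) (w, x) = 0 := hv
    rw [hv'] at h3
    exact h3
  have hw : w = 0 := by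
    apply base_inj
    intro i
    have := (hasDerivAt_pi.1 hline.fst) i
    exact this
  subst hw
  have hx : x = 0 := by
    ext1 k
    apply block_inj
    intro i
    have := hasDerivAt_pi.1 ((hasDerivAt_pi.1 hline.snd) k) i
    simpa [bigF, ha] using this
  rw [hx]; rfl

theorem detA0 : baseF w0 8 = 1 := by
  simp [baseF, w0, mA, Matrix.det_fin_three]

theorem detB0 : baseF w0 9 = 1 := by
  simp [baseF, w0, mB, Matrix.det_fin_three]

theorem detX0 : blockF w0 x0 8 = 1 := by
  simp [blockF, x0, mX, Matrix.det_fin_three]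

theorem pad10 (v : Fin 10 → ℂ) (h8 : v 8 = 1) (h9 : v 9 = 1) :
    ![v (Fin.castLE (by omega) (0 : Fin 8)), v (Fin.castLE (by omega) (1 : Fin 8)), v (Fin.castLE (by omega) (2 : Fin 8)), v (Fin.castLE (by omega) (3 : Fin 8)), v (Fin.castLE (by omega) (4 : Fin 8)), v (Fin.castLE (by omega) (5 : Fin 8)), v (Fin.castLE (by omega) (6 : Fin 8)), v (Fin.castLE (by omega) (7 : Fin 8)), 1, 1] = v := by
  ext i
  fin_cases i
  iterate 8 rfl
  · exact h8.symm
  · exact h9.symm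

theorem pad9 (v : Fin 9 → ℂ) (h8 : v 8 = 1) :
    ![v (Fin.castLE (by omega) (0 : Fin 8)), v (Fin.castLE (by omega) (1 : Fin 8)), v (Fin.castLE (by omega) (2 : Fin 8)), v (Fin.castLE (by omega) (3 : Fin 8)), v (Fin.castLE (by omega) (4 : Fin 8)), v (Fin.castLE (by omega) (5 : Fin 8)), v (Fin.castLE (by omega) (6 : Fin 8)), v (Fin.castLE (by omega) (7 : Fin 8)), 1] = v := by
  ext i
  fin_cases i
  iterate 8 rfl
  · exact h8.symm

theorem aeval_fun_apply {σ S : Type*} (f : σ → S → ℂ) (P : MvPolynomial σ ℂ) (X : S) :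
    (MvPolynomial.aeval f P) X = MvPolynomial.eval (fun i => f i X) P := by
  induction P using MvPolynomial.induction_on with
  | C a => simp
  | add p q hp hq => simp [hp, hq]
  | mul_X p i hp => simp [hp]

theorem trace_functions_algebraically_independent
    (r : ℕ) (hr : 3 ≤ r) :
    AlgebraicIndependent ℂ
      (Sum.elim (fun j : Fin 8 => baseBlock r hr j)
        (fun p : {k : Fin r // 2 ≤ (k : ℕ)} × Fin 8 => fun X : Fin r → SL3 =>
          ![tr3 (X p.1.1),
            tr3 (X p.1.1)⁻¹,
            tr3 (X ⟨0, by omega⟩ * X p.1.1),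
            tr3 (X ⟨1, by omega⟩ * X p.1.1),
            tr3 (X ⟨0, by omega⟩ * (X p.1.1)⁻¹),
            tr3 ((X ⟨0, by omega⟩)⁻¹ * (X p.1.1)⁻¹),
            tr3 ((X ⟨0, by omega⟩)⁻¹ * X p.1.1),
            tr3 (X ⟨1, by omega⟩ * (X p.1.1)⁻¹)] p.2)) := by
  classical
  set κ := {k : Fin r // 2 ≤ (k : ℕ)} with hκ
  rw [algebraicIndependent_iff]
  intro P hP
  -- the inclusion of trace values, with all determinants set to one
  let emb : (Fin 8 ⊕ κ × Fin 8 → ℂ) → (Fin 10 → ℂ) × (κ → Fin 9 → ℂ) := fun y =>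
    (![y (.inl 0), y (.inl 1), y (.inl 2), y (.inl 3), y (.inl 4), y (.inl 5), y (.inl 6),
      y (.inl 7), 1, 1],
     fun k => ![y (.inr (k, 0)), y (.inr (k, 1)), y (.inr (k, 2)), y (.inr (k, 3)),
      y (.inr (k, 4)), y (.inr (k, 5)), y (.inr (k, 6)), y (.inr (k, 7)), 1])
  have hemb : Continuous emb := by
    refine Continuous.prodMk ?_ ?_
    · refine continuous_pi fun i => ?_
      fin_cases i <;> simp <;> fun_prop
    · refine continuous_pi fun k => continuous_pi fun i => ?_
      fin_cases i <;> simp <;> fun_prop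
  let y0 : Fin 8 ⊕ κ × Fin 8 → ℂ := Sum.elim (fun j => baseF w0 (Fin.castLE (by omega) j))
    (fun p => blockF w0 x0 (Fin.castLE (by omega) p.2))
  have hy0 : emb y0 = bigF κ (w0, fun _ => x0) := by
    refine Prod.ext ?_ ?_
    · exact pad10 (baseF w0) detA0 detB0
    · funext k
      exact pad9 (blockF w0 x0) detX0
  have hrange : Set.range (bigF κ) ∈ 𝓝 (emb y0) := by
    rw [hy0, ← bigF_nhds]
    exact Filter.range_mem_map
  have hpre := hemb.continuousAt.preimage_mem_nhds hrange
  obtain ⟨ε, hε, hball⟩ := Metric.mem_nhds_iff.1 hpre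
  refine MvPolynomial.funext_set (fun i => Metric.ball (y0 i) ε) (fun i => ?_) ?_
  · exact infinite_of_mem_nhds (y0 i) (Metric.ball_mem_nhds _ hε)
  · intro y hy
    have hy' : y ∈ Metric.ball y0 ε := by
      rw [ball_pi _ hε]; exact hy
    obtain ⟨⟨w, x⟩, hwx⟩ := hball hy'
    have h1 : baseF w = (emb y).1 := congrArg Prod.fst hwx
    have h2 : ∀ k, blockF w (x k) = (emb y).2 k := fun k => congrFun (congrArg Prod.snd hwx) k
    have dA : (mA w).det = 1 := congrFun h1 8
    have dB : (mB w).det = 1 := congrFun h1 9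
    have dX : ∀ k, (mX (x k)).det = 1 := fun k => congrFun (h2 k) 8
    let X : Fin r → SL3 := fun k =>
      if hk : 2 ≤ (k : ℕ) then ⟨mX (x ⟨k, hk⟩), dX _⟩
      else if (k : ℕ) = 0 then ⟨mA w, dA⟩ else ⟨mB w, dB⟩
    have X0 : X ⟨0, by omega⟩ = ⟨mA w, dA⟩ := by simp [X]; rfl
    have X1 : X ⟨1, by omega⟩ = ⟨mB w, dB⟩ := by simp [X]; rfl
    have Xk : ∀ k : κ, X k.1 = ⟨mX (x k), dX k⟩ := fun k => by simp [X, k.2]; rfl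
    have hval := congrFun hP X
    rw [aeval_fun_apply] at hval
    rw [map_zero]
    refine Eq.trans ?_ hval
    congr 2
    funext i
    rcases i with j | ⟨k, j⟩
    · have hj : y (.inl j) = baseF w (Fin.castLE (by omega) j) := by
        rw [h1]; fin_cases j <;> rfl
      rw [hj]
      simp only [Sum.elim_inl, baseBlock, X0, X1, tr3, Matrix.SpecialLinearGroup.coe_mul,
        Matrix.SpecialLinearGroup.coe_inv]
      fin_cases j <;> rfl
    · have hj : y (.inr (k, j)) = blockF w (x k) (Fin.castLE (by omega) j) := by
        rw [h2]; fin_cases j <;> rfl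
      rw [hj]
      simp only [Sum.elim_inr, Xk, X0, X1, tr3, Matrix.SpecialLinearGroup.coe_mul,
        Matrix.SpecialLinearGroup.coe_inv]
      fin_cases j <;> rfl
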